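/- arXiv:2507.15515 — 4 statements merged into one kernel-verified Lean document; each statement's English description precedes it below -/
import Mathlib

section
/- Let L ≥ 1, λ > 0, Γ ∈ ℂ^L, and let n_1, …, n_L ∈ ℝ² satisfy ‖n_i‖ ≤ 1 for all i. For u ∈ ℝ² define Ψ(u) = Re(∑_{i=1}^L conj(Γ_i) · exp(𝕛 (2π/λ) ⟨n_i, u⟩)), where 𝕛 is the imaginary unit and ⟨·,·⟩ is the standard inner product on ℝ². For u₀ ∈ ℝ² define the vector G(u₀) ∈ ℝ² whose a-th component is Re(∑_{i=1}^L conj(Γ_i) · 𝕛 (2π/λ) (n_i)_a · exp(𝕛 (2π/λ) ⟨n_i, u₀⟩)). Then for all u, u₀ ∈ ℝ²: Ψ(u) ≥ Ψ(u₀) + ⟨G(u₀), u − u₀⟩ − (4π²/λ²) (∑_{i=1}^L |Γ_i|) ‖u − u₀‖², with equality when u = u₀. -/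
open scoped RealInnerProductSpace

open Complex in
lemma exp_rem_bound (x : ℝ) : ‖exp (I * x) - 1 - I * x‖ ≤ x ^ 2 := by
  have hI : ∀ y : ℝ, ‖I * (y : ℂ)‖ = |y| := fun y => by simp
  by_cases hx : |x| ≤ 2
  · have hy : |x / 2| ≤ 1 := by
      rw [abs_div, abs_of_pos (by norm_num : (0 : ℝ) < 2)]; linarith
    have h1 := Real.norm_exp_I_mul_ofReal_sub_one_le (x := x / 2)
    have h2 := Complex.norm_exp_sub_one_sub_id_le (x := I * ((x / 2 : ℝ) : ℂ))
      (by rw [hI]; exact hy)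
    rw [hI, sq_abs] at h2
    have e : exp (I * x) = exp (I * ((x / 2 : ℝ) : ℂ)) ^ 2 := by
      rw [sq, ← Complex.exp_add]; congr 1; push_cast; ring
    have e2 : exp (I * x) - 1 - I * x = (exp (I * ((x / 2 : ℝ) : ℂ)) - 1) ^ 2
        + 2 * (exp (I * ((x / 2 : ℝ) : ℂ)) - 1 - I * ((x / 2 : ℝ) : ℂ)) := by
      rw [e]; push_cast; ring
    rw [e2]
    refine (norm_add_le _ _).trans ?_
    rw [norm_pow, norm_mul, Complex.norm_two]
    have h3 : ‖exp (I * ((x / 2 : ℝ) : ℂ)) - 1‖ ^ 2 ≤ (x / 2) ^ 2 := by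
      rw [← sq_abs (x / 2)]
      exact pow_le_pow_left₀ (norm_nonneg _) h1 2
    nlinarith [sq_nonneg x]
  · push Not at hx
    have h1 := Real.norm_exp_I_mul_ofReal_sub_one_le (x := x)
    refine (norm_sub_le _ _).trans ?_
    rw [hI]
    rw [Real.norm_eq_abs] at h1
    rw [← sq_abs]
    nlinarith

lemma term_bound (g : ℂ) (k a b M : ℝ) (h : |b - a| ≤ M) :
    (g * Complex.exp (Complex.I * k * a)).re
      + (g * (Complex.I * k * ((b - a : ℝ) : ℂ)) * Complex.exp (Complex.I * k * a)).re
      - k ^ 2 * ‖g‖ * M ^ 2 ≤ (g * Complex.exp (Complex.I * k * b)).re := by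
  have hr := exp_rem_bound (k * (b - a))
  have e : Complex.exp (Complex.I * k * b) =
      Complex.exp (Complex.I * k * a) * Complex.exp (Complex.I * ((k * (b - a) : ℝ) : ℂ)) := by
    rw [← Complex.exp_add]; congr 1; push_cast; ring
  have hn : ‖Complex.exp (Complex.I * k * a)‖ = 1 := by
    have := Complex.norm_exp_ofReal_mul_I (k * a)
    rw [← this]; congr 2; push_cast; ring
  set z := g * Complex.exp (Complex.I * k * a) *
    (Complex.exp (Complex.I * ((k * (b - a) : ℝ) : ℂ)) - 1 - Complex.I * ((k * (b - a) : ℝ) : ℂ))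
    with hz
  have hzn : ‖z‖ ≤ k ^ 2 * ‖g‖ * M ^ 2 := by
    rw [hz, norm_mul, norm_mul, hn, mul_one]
    have hM : (b - a) ^ 2 ≤ M ^ 2 := by
      rw [← sq_abs]; exact pow_le_pow_left₀ (abs_nonneg _) h 2
    calc _ ≤ ‖g‖ * (k * (b - a)) ^ 2 := by gcongr
      _ = k ^ 2 * ‖g‖ * (b - a) ^ 2 := by ring
      _ ≤ _ := by gcongr
  have hre := (abs_le.1 (Complex.abs_re_le_norm z)).1
  have e3 : g * Complex.exp (Complex.I * k * b) = g * Complex.exp (Complex.I * k * a)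
      + g * (Complex.I * k * ((b - a : ℝ) : ℂ)) * Complex.exp (Complex.I * k * a) + z := by
    rw [e, hz]; push_cast; ring
  rw [e3, Complex.add_re, Complex.add_re]
  linarith

/-- Lemma 2, lower bound: the field-response objective
`Ψ(u) = Re(∑ᵢ conj(Γᵢ) exp(𝕛(2π/λ)⟨nᵢ,u⟩))` with `‖nᵢ‖ ≤ 1` satisfies the
global quadratic minorization
`Ψ(u) ≥ Ψ(u₀) + ⟨G(u₀), u−u₀⟩ − (4π²/λ²)(∑ᵢ|Γᵢ|)‖u−u₀‖²`, tight at `u = u₀`. -/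
theorem field_response_lower_bound
    (L : ℕ) (hL : 1 ≤ L) (lam : ℝ) (hlam : 0 < lam)
    (Γ : Fin L → ℂ) (n : Fin L → EuclideanSpace ℝ (Fin 2))
    (hn : ∀ i, ‖n i‖ ≤ 1)
    (Ψ : EuclideanSpace ℝ (Fin 2) → ℝ)
    (hΨ : Ψ = fun u => (∑ i, (starRingEnd ℂ) (Γ i) *
        Complex.exp (Complex.I * ((2 * Real.pi / lam : ℝ) : ℂ) * ((⟪n i, u⟫ : ℝ) : ℂ))).re)
    (G : EuclideanSpace ℝ (Fin 2) → EuclideanSpace ℝ (Fin 2))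
    (hG : ∀ u₀ a, G u₀ a = (∑ i, (starRingEnd ℂ) (Γ i) *
        (Complex.I * ((2 * Real.pi / lam : ℝ) : ℂ) * ((n i a : ℝ) : ℂ)) *
        Complex.exp (Complex.I * ((2 * Real.pi / lam : ℝ) : ℂ) * ((⟪n i, u₀⟫ : ℝ) : ℂ))).re)
    (u u₀ : EuclideanSpace ℝ (Fin 2)) :
    Ψ u ≥ Ψ u₀ + ⟪G u₀, u - u₀⟫
        - (4 * Real.pi ^ 2 / lam ^ 2) * (∑ i, ‖Γ i‖) * ‖u - u₀‖ ^ 2 ∧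
    Ψ u₀ = Ψ u₀ + ⟪G u₀, u₀ - u₀⟫
        - (4 * Real.pi ^ 2 / lam ^ 2) * (∑ i, ‖Γ i‖) * ‖u₀ - u₀‖ ^ 2 := by
  refine ⟨?_, by simp⟩
  have hin : ⟪G u₀, u - u₀⟫ = ∑ i, ((starRingEnd ℂ) (Γ i) *
        (Complex.I * ((2 * Real.pi / lam : ℝ) : ℂ) * ((⟪n i, u⟫ - ⟪n i, u₀⟫ : ℝ) : ℂ)) *
        Complex.exp (Complex.I * ((2 * Real.pi / lam : ℝ) : ℂ) * ((⟪n i, u₀⟫ : ℝ) : ℂ))).re := by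
    rw [PiLp.inner_apply, Fin.sum_univ_two, hG, hG]
    simp only [RCLike.inner_apply, conj_trivial, Complex.re_sum]
    rw [Finset.mul_sum, Finset.mul_sum, ← Finset.sum_add_distrib]
    refine Finset.sum_congr rfl fun i _ => ?_
    rw [← Complex.re_ofReal_mul, ← Complex.re_ofReal_mul, ← Complex.add_re]
    congr 1
    rw [← inner_sub_right, PiLp.inner_apply (n i) (u - u₀), Fin.sum_univ_two]
    simp only [RCLike.inner_apply, conj_trivial]
    push_cast
    ring
  rw [hin, hΨ]
  simp only [Complex.re_sum]
  have hk : 4 * Real.pi ^ 2 / lam ^ 2 = (2 * Real.pi / lam) ^ 2 := by ring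
  rw [hk, Finset.mul_sum, Finset.sum_mul, ← Finset.sum_add_distrib, ← Finset.sum_sub_distrib]
  refine Finset.sum_le_sum fun i _ => ?_
  have hb : |⟪n i, u⟫ - ⟪n i, u₀⟫| ≤ ‖u - u₀‖ := by
    rw [← inner_sub_right]
    refine (abs_real_inner_le_norm _ _).trans ?_
    exact mul_le_of_le_one_left (norm_nonneg _) (hn i)
  have := term_bound ((starRingEnd ℂ) (Γ i)) (2 * Real.pi / lam) ⟪n i, u₀⟫ ⟪n i, u⟫ _ hb
  rwa [RCLike.norm_conj] at this
end

section
/- Let L ≥ 1, λ > 0, Γ ∈ ℂ^L, and let n_1, …, n_L ∈ ℝ² satisfy ‖n_i‖ ≤ 1 for all i. For u ∈ ℝ² define Ψ(u) = Re(∑_{i=1}^L conj(Γ_i) · exp(𝕛 (2π/λ) ⟨n_i, u⟩)), where 𝕛 is the imaginary unit and ⟨·,·⟩ is the standard inner product on ℝ². For u₀ ∈ ℝ² define the vector G(u₀) ∈ ℝ² whose a-th component is Re(∑_{i=1}^L conj(Γ_i) · 𝕛 (2π/λ) (n_i)_a · exp(𝕛 (2π/λ) ⟨n_i, u₀⟩)).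 Then for all u, u₀ ∈ ℝ²: Ψ(u) ≤ Ψ(u₀) + ⟨G(u₀), u − u₀⟩ + (4π²/λ²) (∑_{i=1}^L |Γ_i|) ‖u − u₀‖², with equality when u = u₀. -/
open scoped RealInnerProductSpace

theorem exp_I_aux (t : ℝ) :
    ‖Complex.exp (Complex.I * (t : ℂ)) - 1 - Complex.I * (t : ℂ)‖ ≤ t ^ 2 := by
  have hE : ∀ x : ℝ, ‖Complex.exp (Complex.I * (x : ℂ))‖ = 1 := by
    intro x
    rw [mul_comm]
    exact Complex.norm_exp_ofReal_mul_I x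
  have hI : ∀ x : ℝ, ‖Complex.I * (x : ℂ)‖ = |x| := by
    intro x
    simp
  rcases le_or_gt |t| 2 with h | h
  · obtain ⟨s, rfl⟩ : ∃ s, t = 2 * s := ⟨t / 2, by ring⟩
    have hs : |s| ≤ 1 := by
      rw [abs_mul, abs_two] at h
      linarith
    have h1 := Complex.norm_exp_sub_one_sub_id_le (x := Complex.I * (s : ℂ)) (by rw [hI]; exact hs)
    rw [hI, sq_abs] at h1
    have h2 : ‖Complex.exp (Complex.I * (s : ℂ)) - 1‖ ≤ |s| := by
      simpa using Real.norm_exp_I_mul_ofReal_sub_one_le (x := s)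
    have h3 : ‖Complex.exp (Complex.I * (s : ℂ)) + 1‖ ≤ 2 := by
      refine (norm_add_le _ _).trans ?_
      rw [hE, norm_one]
      norm_num
    have e : Complex.exp (Complex.I * ((2 * s : ℝ) : ℂ)) - 1 - Complex.I * ((2 * s : ℝ) : ℂ)
        = (Complex.exp (Complex.I * (s : ℂ)) - 1 - Complex.I * (s : ℂ)) *
            (Complex.exp (Complex.I * (s : ℂ)) + 1)
          + (Complex.I * (s : ℂ)) * (Complex.exp (Complex.I * (s : ℂ)) - 1) := by
      have : Complex.I * ((2 * s : ℝ) : ℂ) = Complex.I * (s : ℂ) + Complex.I * (s : ℂ) := by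
        push_cast
        ring
      rw [this, Complex.exp_add]
      ring
    rw [e]
    refine (norm_add_le _ _).trans ?_
    rw [norm_mul, norm_mul, hI]
    have h4 := mul_le_mul h1 h3 (norm_nonneg _) (sq_nonneg s)
    have h5 := mul_le_mul_of_nonneg_left h2 (abs_nonneg s)
    rw [abs_mul_abs_self] at h5
    nlinarith [sq_nonneg s]
  · refine (norm_sub_le _ _).trans ?_
    have := norm_sub_le (Complex.exp (Complex.I * (t : ℂ))) 1
    rw [hE, norm_one] at this
    rw [hI, ← sq_abs]
    nlinarith

theorem term_aux (c : ℂ) (k s d D : ℝ) (hd : d ^ 2 ≤ D) :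
    ((starRingEnd ℂ) c * Complex.exp (Complex.I * (k : ℂ) * ((s + d : ℝ) : ℂ))).re ≤
    ((starRingEnd ℂ) c * Complex.exp (Complex.I * (k : ℂ) * (s : ℂ))).re +
    ((starRingEnd ℂ) c * (Complex.I * (k : ℂ) * (d : ℂ)) *
      Complex.exp (Complex.I * (k : ℂ) * (s : ℂ))).re + k ^ 2 * ‖c‖ * D := by
  have e : (starRingEnd ℂ) c * Complex.exp (Complex.I * (k : ℂ) * ((s + d : ℝ) : ℂ))
      = (starRingEnd ℂ) c * Complex.exp (Complex.I * (k : ℂ) * (s : ℂ)) +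
        (starRingEnd ℂ) c * (Complex.I * (k : ℂ) * (d : ℂ)) *
          Complex.exp (Complex.I * (k : ℂ) * (s : ℂ)) +
        (starRingEnd ℂ) c * Complex.exp (Complex.I * ((k * s : ℝ) : ℂ)) *
        (Complex.exp (Complex.I * ((k * d : ℝ) : ℂ)) - 1 - Complex.I * ((k * d : ℝ) : ℂ)) := by
    push_cast
    rw [mul_add, Complex.exp_add]
    simp only [← mul_assoc]
    ring
  rw [e, Complex.add_re, Complex.add_re]
  refine add_le_add le_rfl ((Complex.re_le_norm _).trans ?_)
  have h1 : ‖Complex.exp (Complex.I * ((k * s : ℝ) : ℂ))‖ = 1 := by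
    rw [mul_comm]
    exact Complex.norm_exp_ofReal_mul_I _
  rw [norm_mul, norm_mul, h1, mul_one, RCLike.norm_conj]
  have h2 := mul_le_mul_of_nonneg_left (exp_I_aux (k * d)) (norm_nonneg c)
  have h3 := mul_le_mul_of_nonneg_left hd (mul_nonneg (sq_nonneg k) (norm_nonneg c))
  calc _ ≤ _ := h2
    _ = k ^ 2 * ‖c‖ * d ^ 2 := by ring
    _ ≤ _ := h3

/-- Lemma 2, upper bound: the field-response objective
`Ψ(u) = Re(∑ᵢ conj(Γᵢ) exp(𝕛(2π/λ)⟨nᵢ,u⟩))` with `‖nᵢ‖ ≤ 1` satisfies the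
global quadratic majorization
`Ψ(u) ≤ Ψ(u₀) + ⟨G(u₀), u−u₀⟩ + (4π²/λ²)(∑ᵢ|Γᵢ|)‖u−u₀‖²`, tight at `u = u₀`. -/
theorem field_response_upper_bound
    (L : ℕ) (hL : 1 ≤ L) (lam : ℝ) (hlam : 0 < lam)
    (Γ : Fin L → ℂ) (n : Fin L → EuclideanSpace ℝ (Fin 2))
    (hn : ∀ i, ‖n i‖ ≤ 1)
    (Ψ : EuclideanSpace ℝ (Fin 2) → ℝ)
    (hΨ : Ψ = fun u => (∑ i, (starRingEnd ℂ) (Γ i) *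
        Complex.exp (Complex.I * ((2 * Real.pi / lam : ℝ) : ℂ) * ((⟪n i, u⟫ : ℝ) : ℂ))).re)
    (G : EuclideanSpace ℝ (Fin 2) → EuclideanSpace ℝ (Fin 2))
    (hG : ∀ u₀ a, G u₀ a = (∑ i, (starRingEnd ℂ) (Γ i) *
        (Complex.I * ((2 * Real.pi / lam : ℝ) : ℂ) * ((n i a : ℝ) : ℂ)) *
        Complex.exp (Complex.I * ((2 * Real.pi / lam : ℝ) : ℂ) * ((⟪n i, u₀⟫ : ℝ) : ℂ))).re)
    (u u₀ : EuclideanSpace ℝ (Fin 2)) :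
    Ψ u ≤ Ψ u₀ + ⟪G u₀, u - u₀⟫
        + (4 * Real.pi ^ 2 / lam ^ 2) * (∑ i, ‖Γ i‖) * ‖u - u₀‖ ^ 2 ∧
    Ψ u₀ = Ψ u₀ + ⟪G u₀, u₀ - u₀⟫
        + (4 * Real.pi ^ 2 / lam ^ 2) * (∑ i, ‖Γ i‖) * ‖u₀ - u₀‖ ^ 2 := by
  refine ⟨?_, by simp⟩
  have hGd : ⟪G u₀, u - u₀⟫ = ∑ i, ((starRingEnd ℂ) (Γ i) *
      (Complex.I * ((2 * Real.pi / lam : ℝ) : ℂ) * ((⟪n i, u - u₀⟫ : ℝ) : ℂ)) *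
      Complex.exp (Complex.I * ((2 * Real.pi / lam : ℝ) : ℂ) * ((⟪n i, u₀⟫ : ℝ) : ℂ))).re := by
    have hin : ∀ x y : EuclideanSpace ℝ (Fin 2), ⟪x, y⟫ = x 0 * y 0 + x 1 * y 1 := by
      intro x y
      simp [PiLp.inner_apply, Fin.sum_univ_two, mul_comm]
    rw [hin (G u₀), hG, hG, Complex.re_sum, Complex.re_sum, Finset.sum_mul, Finset.sum_mul,
      ← Finset.sum_add_distrib]
    refine Finset.sum_congr rfl fun i _ => ?_
    rw [hin (n i) (u - u₀), ← Complex.re_mul_ofReal, ← Complex.re_mul_ofReal, ← Complex.add_re]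
    congr 1
    push_cast
    ring
  have hk : 4 * Real.pi ^ 2 / lam ^ 2 = (2 * Real.pi / lam) ^ 2 := by
    rw [div_pow]
    ring
  rw [hGd, hk, hΨ]
  simp only [Complex.re_sum]
  rw [Finset.mul_sum, Finset.sum_mul, ← Finset.sum_add_distrib, ← Finset.sum_add_distrib]
  refine Finset.sum_le_sum fun i _ => ?_
  have hd : (⟪n i, u - u₀⟫ : ℝ) ^ 2 ≤ ‖u - u₀‖ ^ 2 := by
    refine sq_le_sq.mpr ?_
    rw [abs_norm]
    refine (abs_real_inner_le_norm _ _).trans ?_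
    exact mul_le_of_le_one_left (norm_nonneg _) (hn i)
  have h := term_aux (Γ i) (2 * Real.pi / lam) ⟪n i, u₀⟫ ⟪n i, u - u₀⟫ _ hd
  have hs : (⟪n i, u₀⟫ : ℝ) + ⟪n i, u - u₀⟫ = ⟪n i, u⟫ := by
    rw [← inner_add_right]
    congr 1
    abel
  rw [hs] at h
  exact h
end

section
/- Let K ≥ 1, M ≥ 1, let h_1, …, h_M ∈ ℂ^K be channel vectors, p_1, …, p_M ≥ 0 transmit powers with p_m > 0 for a fixed index m, σ² > 0, and w ∈ ℂ^K with w ≠ 0. Write ⟨w, v⟩ = wᴴ v (conjugate-linear in the first argument), and set D = ∑_{r=1}^M p_r |⟨w, h_r⟩|² + σ² ‖w‖² > 0 and γ = p_m |⟨w, h_m⟩|² / (∑_{r ≠ m} p_r |⟨w, h_r⟩|² + σ² ‖w‖²). Then log(1 + γ) = sup over ω > 0 and β ∈ ℂ of [log ω − ω (1 − 2 Re(conj(β) √(p_m) ⟨w, h_m⟩) + |β|² D) + 1], where log is the natural logarithm, and the supremum is attained at β* = √(p_m) ⟨w, h_m⟩ / D and ω* = 1 + γ. -/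
open Matrix

theorem mse_ge (a β : ℂ) (D N : ℝ) (hD : 0 < D) (hDN : D = ‖a‖ ^ 2 + N) :
    N / D ≤ 1 - 2 * ((starRingEnd ℂ) β * a).re + ‖β‖ ^ 2 * D := by
  rw [div_le_iff₀ hD]
  have hN : N = D - ‖a‖ ^ 2 := by linarith
  rw [hN]
  simp only [Complex.sq_norm, Complex.normSq_apply, Complex.mul_re, Complex.conj_re,
    Complex.conj_im]
  nlinarith [sq_nonneg (a.re - D * β.re), sq_nonneg (a.im - D * β.im)]

theorem mse_eq (a : ℂ) (D N : ℝ) (hD : 0 < D) (hDN : D = ‖a‖ ^ 2 + N) :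
    1 - 2 * ((starRingEnd ℂ) (a / (D : ℂ)) * a).re + ‖a / (D : ℂ)‖ ^ 2 * D = N / D := by
  have hN : N = D - ‖a‖ ^ 2 := by linarith
  rw [hN]
  simp only [Complex.sq_norm, Complex.normSq_apply, Complex.mul_re, Complex.conj_re,
    Complex.conj_im, Complex.div_ofReal_re, Complex.div_ofReal_im]
  field_simp
  ring

/-- The WMMSE equivalence (Eq. (29), natural-log units): the rate `log(1+γ)`
equals the maximum over `ω > 0` and `β ∈ ℂ` of the weighted MSE surrogate,
attained at `β* = √(p_m) wᴴh_m / D` and `ω* = 1 + γ`. -/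
theorem wmmse_equivalence
    (K M : ℕ) (hK : 1 ≤ K) (hM : 1 ≤ M)
    (h : Fin M → Fin K → ℂ) (p : Fin M → ℝ) (hp : ∀ r, 0 ≤ p r)
    (m : Fin M) (hpm : 0 < p m)
    (σ2 : ℝ) (hσ : 0 < σ2)
    (w : Fin K → ℂ) (hw : w ≠ 0)
    (D γ : ℝ)
    (hD : D = (∑ r, p r * ‖star w ⬝ᵥ h r‖ ^ 2) + σ2 * ∑ i, ‖w i‖ ^ 2)
    (hγ : γ = p m * ‖star w ⬝ᵥ h m‖ ^ 2 /
        ((∑ r ∈ Finset.univ.erase m, p r * ‖star w ⬝ᵥ h r‖ ^ 2) + σ2 * ∑ i, ‖w i‖ ^ 2))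
    (F : ℝ → ℂ → ℝ)
    (hF : F = fun ω β => Real.log ω
        - ω * (1 - 2 * ((starRingEnd ℂ) β * ((Real.sqrt (p m) : ℝ) : ℂ) * (star w ⬝ᵥ h m)).re
            + ‖β‖ ^ 2 * D) + 1) :
    0 < D ∧
    (∀ ω : ℝ, 0 < ω → ∀ β : ℂ, F ω β ≤ Real.log (1 + γ)) ∧
    F (1 + γ) (((Real.sqrt (p m) : ℝ) : ℂ) * (star w ⬝ᵥ h m) / ((D : ℝ) : ℂ)) =
      Real.log (1 + γ) := by
  have hW : 0 < σ2 * ∑ i, ‖w i‖ ^ 2 := by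
    obtain ⟨i, hi⟩ := Function.ne_iff.mp hw
    refine mul_pos hσ (Finset.sum_pos' (fun _ _ => by positivity) ⟨i, Finset.mem_univ i, ?_⟩)
    have : 0 < ‖w i‖ := norm_pos_iff.mpr hi
    positivity
  have hE : 0 ≤ ∑ r ∈ Finset.univ.erase m, p r * ‖star w ⬝ᵥ h r‖ ^ 2 :=
    Finset.sum_nonneg fun r _ => mul_nonneg (hp r) (by positivity)
  rw [← Finset.add_sum_erase _ _ (Finset.mem_univ m), add_assoc] at hD
  set N := (∑ r ∈ Finset.univ.erase m, p r * ‖star w ⬝ᵥ h r‖ ^ 2) + σ2 * ∑ i, ‖w i‖ ^ 2 with hNdef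
  have hN : 0 < N := by linarith
  have hA : ‖((Real.sqrt (p m) : ℝ) : ℂ) * (star w ⬝ᵥ h m)‖ ^ 2
      = p m * ‖star w ⬝ᵥ h m‖ ^ 2 := by
    rw [norm_mul, mul_pow, Complex.norm_real, Real.norm_eq_abs, sq_abs, Real.sq_sqrt hpm.le]
  rw [← hA] at hD hγ
  have hD0 : 0 < D := by rw [hD]; positivity
  have hg : 1 + γ = D / N := by
    rw [hγ, hD]; field_simp; ring
  simp only [hF, mul_assoc, hg]
  refine ⟨hD0, fun ω hω β => ?_, ?_⟩
  · have h1 := mul_le_mul_of_nonneg_left (mse_ge _ β D N hD0 hD) hω.le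
    have h2 := Real.log_le_sub_one_of_pos (show 0 < ω * (N / D) by positivity)
    rw [Real.log_mul hω.ne' (by positivity), Real.log_div hN.ne' hD0.ne'] at h2
    rw [Real.log_div hD0.ne' hN.ne']
    linarith
  · rw [mse_eq _ D N hD0 hD]
    have : D / N * (N / D) = 1 := by field_simp
    rw [this]; ring
end

section
/- Let M ≥ 1, a_1, …, a_M ≥ 0, c > 0, and let t, t⁰ ∈ ℝ^M with t_r > 0 and t_r⁰ > 0 for all r. Set S⁰ = ∑_{r=1}^M a_r / t_r⁰ + c. Then log₂(∑_{r=1}^M a_r / t_r + c) ≥ log₂(S⁰) + (1 / log 2) · ∑_{r=1}^M (a_r / (t_r⁰)²) / S⁰ · (t_r⁰ − t_r), with equality when t = t⁰. -/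
/-- The explicit SCA lower bound (surrogate of Eq. (22)) used in the trajectory
subproblem (P2-1): for `a_r ≥ 0`, `c > 0`, and positive `t, t⁰`,
`log₂(∑ a_r/t_r + c) ≥ log₂(S⁰) + (1/ln 2) ∑_r (a_r/(t⁰_r)²)/S⁰ · (t⁰_r − t_r)`
with `S⁰ = ∑ a_r/t⁰_r + c`, with equality when `t = t⁰`. -/
theorem sca_log_lower_bound
    (M : ℕ) (hM : 1 ≤ M) (a : Fin M → ℝ) (ha : ∀ r, 0 ≤ a r)
    (c : ℝ) (hc : 0 < c)
    (t t0 : Fin M → ℝ) (ht : ∀ r, 0 < t r) (ht0 : ∀ r, 0 < t0 r)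
    (S0 : ℝ) (hS0 : S0 = (∑ r, a r / t0 r) + c) :
    Real.logb 2 ((∑ r, a r / t r) + c) ≥
      Real.logb 2 S0 + (1 / Real.log 2) * ∑ r, a r / (t0 r) ^ 2 / S0 * (t0 r - t r) ∧
    (t = t0 →
      Real.logb 2 ((∑ r, a r / t r) + c) =
        Real.logb 2 S0 + (1 / Real.log 2) * ∑ r, a r / (t0 r) ^ 2 / S0 * (t0 r - t r)) := by
  have hsum : 0 ≤ ∑ r, a r / t0 r :=
    Finset.sum_nonneg fun r _ => div_nonneg (ha r) (ht0 r).le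
  have hS0pos : 0 < S0 := by rw [hS0]; linarith
  have hlog : 0 < Real.log 2 := Real.log_pos (by norm_num)
  refine ⟨?_, ?_⟩
  · set L := ∑ r, a r / (t0 r) ^ 2 / S0 * (t0 r - t r) with hL
    have key : ∀ u : ℝ, Real.exp L * (1 + u - L) ≤ Real.exp u := by
      intro u
      have h1 := Real.add_one_le_exp (u - L)
      have h2 : Real.exp u = Real.exp L * Real.exp (u - L) := by
        rw [← Real.exp_add]; ring_nf
      rw [h2]
      exact mul_le_mul_of_nonneg_left (by linarith) (Real.exp_pos L).le
    have term : ∀ r, Real.exp L *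
        (a r / t0 r + S0 * (a r / (t0 r) ^ 2 / S0 * (t0 r - t r)) - L * (a r / t0 r))
          ≤ a r / t r := by
      intro r
      have h0 := ht0 r
      have h1 := ht r
      have hx : 0 < t r / t0 r := div_pos h1 h0
      have h2 : Real.exp (1 - t r / t0 r) ≤ t0 r / t r := by
        have h3 := Real.add_one_le_exp (t r / t0 r - 1)
        have h4 : Real.exp (1 - t r / t0 r) = (Real.exp (t r / t0 r - 1))⁻¹ := by
          rw [← Real.exp_neg]; ring_nf
        rw [h4, ← inv_div (t r) (t0 r)]
        exact inv_anti₀ hx (by linarith)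
      have h5 := (key (1 - t r / t0 r)).trans h2
      have h6 := mul_le_mul_of_nonneg_left h5 (div_nonneg (ha r) h0.le)
      have e1 : a r / t0 r * (t0 r / t r) = a r / t r := by field_simp
      have e2 : S0 * (a r / (t0 r) ^ 2 / S0 * (t0 r - t r))
          = a r / t0 r * (1 - t r / t0 r) := by field_simp
      rw [e1] at h6
      rw [e2]
      linarith
    have hcc : Real.exp L * (c - L * c) ≤ c := by
      have h := mul_le_mul_of_nonneg_left (key 0) hc.le
      rw [Real.exp_zero] at h
      linarith
    have hs := Finset.sum_le_sum fun r (_ : r ∈ Finset.univ) => term r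
    rw [← Finset.mul_sum, Finset.sum_sub_distrib, Finset.sum_add_distrib,
      ← Finset.mul_sum, ← Finset.mul_sum, ← hL] at hs
    have hA : ∑ r, a r / t0 r = S0 - c := by linarith
    rw [hA] at hs
    have hfin : S0 * Real.exp L ≤ (∑ r, a r / t r) + c := by linarith
    have hl := Real.log_le_log (mul_pos hS0pos (Real.exp_pos L)) hfin
    rw [Real.log_mul hS0pos.ne' (Real.exp_pos L).ne', Real.log_exp] at hl
    have hd := div_le_div_of_nonneg_right hl hlog.le
    rw [add_div] at hd
    simp only [Real.logb, ge_iff_le]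
    rw [one_div_mul_eq_div]
    exact hd
  · rintro rfl
    simp [hS0]
end
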